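/- Let ∘ and ∗ be two pre-Lie algebra structures on a vector space A. Then for every pair of scalars k₁,k₂ ∈ K the operation x⋆y = k₁(x∘y) + k₂(x∗y) is a pre-Lie algebra structure on A if and only if (x∘y)∗z − x∗(y∘z) + (x∗y)∘z − x∘(y∗z) = (y∘x)∗z − y∗(x∘z) + (y∗x)∘z − y∘(x∗z) for all x,y,z ∈ A. -/

import Mathlib

open LinearMap Module

/-- `(A, succ, prec)` is a dendriform algebra. -/
def IsDendriform (K : Type*) [Field K] {A : Type*} [AddCommGroup A] [Module K A]
    (succ prec : A →ₗ[K] A →ₗ[K] A) : Prop :=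
  (∀ x y z, prec (prec x y) z = prec x (succ y z + prec y z)) ∧
  (∀ x y z, prec (succ x y) z = succ x (prec y z)) ∧
  (∀ x y z, succ x (succ y z) = succ (succ x y + prec x y) z)

/-- `(A, ast)` is a pre-Lie algebra. -/
def IsPreLie (K : Type*) [Field K] {A : Type*} [AddCommGroup A] [Module K A]
    (ast : A →ₗ[K] A →ₗ[K] A) : Prop :=
  ∀ x y z, ast (ast x y) z - ast x (ast y z) = ast (ast y x) z - ast y (ast x z)

/-- `(A, succ, prec, ast)` is a noncommutative pre-Poisson algebra. -/
def IsNCPrePoisson (K : Type*) [Field K] {A : Type*} [AddCommGroup A] [Module K A]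
    (succ prec ast : A →ₗ[K] A →ₗ[K] A) : Prop :=
  IsDendriform K succ prec ∧ IsPreLie K ast ∧
  (∀ x y z, succ (ast x y - ast y x) z = ast x (succ y z) - succ y (ast x z)) ∧
  (∀ x y z, prec x (ast y z - ast z y) = ast y (prec x z) - prec (ast y x) z) ∧
  (∀ x y z, ast (succ x y + prec x y) z = prec (ast x z) y + succ x (ast y z))

/-- A noncommutative pre-Poisson algebra is coherent if
`(x≻y + x≺y)∗z = x∗(y≻z) + y∗(z≺x)`. -/
def IsCoherentNCPrePoisson (K : Type*) [Field K] {A : Type*} [AddCommGroup A]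
    [Module K A] (succ prec ast : A →ₗ[K] A →ₗ[K] A) : Prop :=
  IsNCPrePoisson K succ prec ast ∧
  (∀ x y z, ast (succ x y + prec x y) z = ast x (succ y z) + ast y (prec z x))

/-- two pre-Lie structures `∘` and `∗` are compatible (every
linear combination `k₁∘ + k₂∗` is pre-Lie) iff the mixed pre-Lie identity
holds. -/
theorem compatible_preLie_iff {K A : Type*} [Field K] [CharZero K]
    [AddCommGroup A] [Module K A]
    (circ ast : A →ₗ[K] A →ₗ[K] A)
    (h₁ : IsPreLie K circ) (h₂ : IsPreLie K ast) :
    (∀ k₁ k₂ : K, IsPreLie K (k₁ • circ + k₂ • ast)) ↔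
    (∀ x y z,
      ast (circ x y) z - ast x (circ y z) + circ (ast x y) z - circ x (ast y z) =
      ast (circ y x) z - ast y (circ x z) + circ (ast y x) z - circ y (ast x z)) := by
  constructor
  · intro h x y z
    have h3 := h 1 1 x y z
    have h1 := h₁ x y z
    have h2 := h₂ x y z
    simp only [LinearMap.add_apply, LinearMap.smul_apply, map_add, one_smul] at h3
    linear_combination (norm := module) h3 - h1 - h2
  · intro h k₁ k₂ x y z
    have h3 := h x y z
    have h1 := h₁ x y z
    have h2 := h₂ x y z
    simp only [LinearMap.add_apply, LinearMap.smul_apply, map_add, map_smul]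
    linear_combination (norm := module) (k₁ * k₁) • h1 + (k₂ * k₂) • h2 + (k₁ * k₂) • h3
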